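/- arXiv:1610.08299 — 2 statements merged into one kernel-verified Lean document; each statement's English description precedes it below -/
import Mathlib

section
/- Let β = −b where b ∈ ℤ, b ≥ 2. Then every alphabet A of contiguous integers containing 0 with cardinality #A = b+1 allows parallel addition on Fin_A(β); moreover, this cardinality cannot be reduced: no alphabet of contiguous integers containing 0 and 1 of cardinality at most b allows parallel addition on Fin_A(β). -/
open scoped Pointwise

/-- The value `∑_{j ∈ ℤ} u_j β^j` of a (finitely supported) bi-infinite digit string. -/
noncomputable def seqValue (β : ℝ) (u : ℤ → ℝ) : ℝ := ∑ᶠ j : ℤ, u j * β ^ j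

/-- `φ` is a `p`-local function realized by `Φ` (with memory `r` and anticipation `t`,
`p = r + t + 1`, and `(φ u) j = Φ (u_{j+t}, …, u_{j-r})`). -/
def IsLocallyRealized (p : ℕ) (φ : (ℤ → ℝ) → ℤ → ℝ) (Φ : (Fin p → ℝ) → ℝ) : Prop :=
  ∃ r t : ℕ, p = r + t + 1 ∧
    ∀ (u : ℤ → ℝ) (j : ℤ), φ u j = Φ (fun i => u (j + (t : ℤ) - ((i : ℕ) : ℤ)))

/-- `φ` is a digit set conversion in base `β` from alphabet `A` to alphabet `B`:
it maps `A`-valued strings to `B`-valued strings, preserves finiteness of support,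
and preserves the represented value. -/
def IsDigitSetConversion (β : ℝ) (A B : Set ℝ) (φ : (ℤ → ℝ) → ℤ → ℝ) : Prop :=
  (∀ u : ℤ → ℝ, (∀ j, u j ∈ A) → ∀ j, φ u j ∈ B) ∧
  ∀ u : ℤ → ℝ, (∀ j, u j ∈ A) → (Function.support u).Finite →
    (Function.support (φ u)).Finite ∧ seqValue β (φ u) = seqValue β u

/-- There is a digit set conversion in base `β` from `A` to `B` computable in parallel. -/
def ParallelConversion (β : ℝ) (A B : Set ℝ) : Prop :=
  ∃ (p : ℕ) (φ : (ℤ → ℝ) → ℤ → ℝ) (Φ : (Fin p → ℝ) → ℝ),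
    IsLocallyRealized p φ Φ ∧ IsDigitSetConversion β A B φ

/-- Addition on `Fin_A(β)` can be performed in parallel: there is a parallel digit set
conversion from `A + A` to `A`. -/
def ParallelAddition (β : ℝ) (A : Set ℝ) : Prop :=
  ParallelConversion β (A + A) A

/-- The alphabet of contiguous integers `{m, …, M}`, viewed inside `ℝ`. -/
def intAlphabet (m M : ℤ) : Set ℝ := (fun k : ℤ => (k : ℝ)) '' Set.Icc m M

/-! ### Linearity of the value of a digit string -/

theorem seqValue_add {β : ℝ} {u v : ℤ → ℝ} (hu : u.support.Finite) (hv : v.support.Finite) :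
    seqValue β (u + v) = seqValue β u + seqValue β v := by
  unfold seqValue
  rw [← finsum_add_distrib (hu.subset fun j hj => left_ne_zero_of_mul hj)
    (hv.subset fun j hj => left_ne_zero_of_mul hj)]
  simp [add_mul]

theorem seqValue_smul (β c : ℝ) (u : ℤ → ℝ) : seqValue β (c • u) = c * seqValue β u := by
  unfold seqValue
  rw [← smul_eq_mul c, smul_finsum]
  simp [mul_assoc]

theorem seqValue_sub {β : ℝ} {u v : ℤ → ℝ} (hu : u.support.Finite) (hv : v.support.Finite) :
    seqValue β (u - v) = seqValue β u - seqValue β v := by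
  have h : u - v = u + (-1 : ℝ) • v := by ext; simp [sub_eq_add_neg]
  rw [h, seqValue_add hu (hv.subset (Function.support_const_smul_subset _ _)), seqValue_smul]
  ring

theorem seqValue_shift {β : ℝ} (hβ : β ≠ 0) (u : ℤ → ℝ) :
    seqValue β (fun j => u (j - 1)) = β * seqValue β u := by
  unfold seqValue
  rw [← finsum_comp_equiv (Equiv.addRight (1 : ℤ)), ← smul_eq_mul, smul_finsum]
  refine finsum_congr fun j => ?_
  simp only [Equiv.coe_addRight, add_sub_cancel_right, zpow_add_one₀ hβ, smul_eq_mul]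
  ring

theorem seqValue_single (β x : ℝ) (k : ℤ) : seqValue β (Pi.single k x) = x * β ^ k := by
  unfold seqValue
  rw [finsum_eq_single _ k fun j hj => by simp [hj]]
  simp

theorem finite_support_shift {u : ℤ → ℝ} (hu : u.support.Finite) :
    (Function.support fun j => u (j - 1)).Finite :=
  hu.preimage (f := fun j : ℤ => j - 1) fun _ _ _ _ h => by simpa using h

theorem finite_support_sub {u v : ℤ → ℝ} (hu : u.support.Finite) (hv : v.support.Finite) :
    (u - v).support.Finite :=
  (hu.union hv).subset (Function.support_sub u v)

/-- Integer digits at nonnegative positions give an integer value in an integer base. -/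
theorem exists_int_seqValue (β : ℤ) {u : ℤ → ℝ} (hu : ∀ j, ∃ k : ℤ, u j = k)
    (hneg : ∀ j < 0, u j = 0) : ∃ k : ℤ, seqValue (β : ℝ) u = k := by
  unfold seqValue
  refine finsum_induction (fun x : ℝ => ∃ k : ℤ, x = k) ⟨0, by simp⟩ ?_ fun j => ?_
  · rintro _ _ ⟨k, rfl⟩ ⟨l, rfl⟩
    exact ⟨k + l, by simp⟩
  · obtain ⟨k, hk⟩ := hu j
    rcases lt_or_ge j 0 with hj | hj
    · exact ⟨0, by simp [hneg j hj]⟩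
    · lift j to ℕ using hj
      exact ⟨k * β ^ j, by simp [hk]⟩

/-! ### Alphabets of contiguous integers -/

theorem mem_intAlphabet {m M : ℤ} {x : ℝ} :
    x ∈ intAlphabet m M ↔ ∃ k : ℤ, m ≤ k ∧ k ≤ M ∧ (k : ℝ) = x := by
  simp [intAlphabet, and_assoc]

theorem exists_int_of_mem_add {m M : ℤ} {x : ℝ} (hx : x ∈ intAlphabet m M + intAlphabet m M) :
    ∃ k : ℤ, 2 * m ≤ k ∧ k ≤ 2 * M ∧ (k : ℝ) = x := by
  obtain ⟨y, hy, z, hz, rfl⟩ := Set.mem_add.1 hx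
  obtain ⟨k, hk, hk', rfl⟩ := mem_intAlphabet.1 hy
  obtain ⟨l, hl, hl', rfl⟩ := mem_intAlphabet.1 hz
  exact ⟨k + l, by omega, by omega, by simp⟩

/-! ### The conversion: carries are known up to one from the previous digit -/

/-- A lower bound, off by at most one, for the carry produced by the digit `x`. -/
def carryBound (b m hi x : ℤ) : ℤ := min hi ((x - m - 1 - hi) / b)

/-- The carry produced by the digit `x` preceded by the digit `y`. -/
def carry (b m hi x y : ℤ) : ℤ := (x - m - 1 - carryBound b m hi y) / b

theorem carry_mem {b m lo hi x y : ℤ} (hb : 0 < b) (hlh : lo ≤ hi) (hhl : hi - lo ≤ b)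
    (hlo : b * lo ≤ m - 1 - hi) (hhi : m + 2 * b - 1 - lo < b * (hi + 2))
    (hx : x ≤ 2 * (m + b)) (hy : 2 * m ≤ y) :
    carryBound b m hi x ≤ carry b m hi x y ∧ carry b m hi x y ≤ carryBound b m hi x + 1 := by
  have bound : lo ≤ carryBound b m hi y ∧ carryBound b m hi y ≤ hi :=
    ⟨le_min hlh ((Int.le_ediv_iff_mul_le hb).2 (by linarith)), min_le_left _ _⟩
  unfold carry
  generalize carryBound b m hi y = l at bound
  obtain ⟨h₁, h₂⟩ := bound
  have mono : (x - m - 1 - hi) / b ≤ (x - m - 1 - l) / b := Int.ediv_le_ediv hb (by omega)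
  have step : (x - m - 1 - l) / b ≤ (x - m - 1 - hi) / b + 1 := by
    have h := Int.add_mul_ediv_right (x - m - 1 - hi) 1 hb.ne'
    rw [← h]
    exact Int.ediv_le_ediv hb (by omega)
  have top : (x - m - 1 - l) / b ≤ hi + 1 :=
    Int.lt_add_one_iff.1 ((Int.ediv_lt_iff_lt_mul hb).2 (by linarith))
  unfold carryBound
  omega

/-- The new digit, computed from the old one `x` and the two preceding ones `y` and `z`. -/
def convertedDigit (b m hi x y z : ℤ) : ℤ := x - b * carry b m hi x y - carry b m hi y z

theorem convertedDigit_mem {b m lo hi x y z : ℤ} (hb : 0 < b) (hlh : lo ≤ hi) (hhl : hi - lo ≤ b)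
    (hlo : b * lo ≤ m - 1 - hi) (hhi : m + 2 * b - 1 - lo < b * (hi + 2))
    (hy : y ≤ 2 * (m + b)) (hz : 2 * m ≤ z) :
    m ≤ convertedDigit b m hi x y z ∧ convertedDigit b m hi x y z ≤ m + b := by
  have h := carry_mem hb hlh hhl hlo hhi hy hz
  have h₁ := Int.mul_ediv_add_emod (x - m - 1 - carryBound b m hi y) b
  have h₂ := Int.emod_nonneg (x - m - 1 - carryBound b m hi y) hb.ne'
  have h₃ := Int.emod_lt_of_pos (x - m - 1 - carryBound b m hi y) hb
  rw [convertedDigit, show carry b m hi x y = (x - m - 1 - carryBound b m hi y) / b from rfl]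
  constructor <;> linarith [h.1, h.2]

theorem exists_carry_range {b m : ℤ} (hb : 2 ≤ b) (hm : m ≤ 0) (hm' : 0 ≤ m + b) :
    ∃ lo hi : ℤ, lo ≤ hi ∧ hi - lo ≤ b ∧ b * lo ≤ m - 1 - hi ∧
      m + 2 * b - 1 - lo < b * (hi + 2) := by
  rcases eq_or_lt_of_le hm with rfl | hm
  · exact ⟨-1, 1, by omega, by omega, by omega, by omega⟩
  rcases eq_or_lt_of_le hm' with h | h
  · exact ⟨-2, 0, by omega, by omega, by omega, by omega⟩
  · exact ⟨-1, 0, by omega, by omega, by omega, by omega⟩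

theorem parallelAddition_neg_base {b m : ℤ} (hb : 2 ≤ b) (hm : m ≤ 0) (hm' : 0 ≤ m + b) :
    ParallelAddition (-(b : ℝ)) (intAlphabet m (m + b)) := by
  obtain ⟨lo, hi, hlh, hhl, hlo, hhi⟩ := exists_carry_range hb hm hm'
  have hb0 : 0 < b := by omega
  refine ⟨3, fun u j => convertedDigit b m hi ⌊u j⌋ ⌊u (j - 1)⌋ ⌊u (j - 2)⌋,
    fun x => convertedDigit b m hi ⌊x 0⌋ ⌊x 1⌋ ⌊x 2⌋, ⟨2, 0, rfl, fun u j => by simp⟩, ?_, ?_⟩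
  · intro u hu j
    obtain ⟨y, -, hy', hyu⟩ := exists_int_of_mem_add (hu (j - 1))
    obtain ⟨z, hz, -, hzu⟩ := exists_int_of_mem_add (hu (j - 2))
    simp only [← hyu, ← hzu, Int.floor_intCast]
    have h := convertedDigit_mem (x := ⌊u j⌋) hb0 hlh hhl hlo hhi hy' hz
    exact mem_intAlphabet.2 ⟨_, h.1, h.2, rfl⟩
  · intro u hu hfin
    choose d _ _ hd using fun j => exists_int_of_mem_add (hu j)
    obtain rfl : (fun j => (d j : ℝ)) = u := funext hd
    simp only [Int.floor_intCast]
    have hzero : carry b m hi 0 0 = 0 := by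
      have h := convertedDigit_mem (x := 0) (y := 0) (z := 0) hb0 hlh hhl hlo hhi
        (by omega) (by omega)
      unfold convertedDigit at h
      have h₁ : -1 < carry b m hi 0 0 := by by_contra! hc; nlinarith
      have h₂ : carry b m hi 0 0 < 1 := by by_contra! hc; nlinarith
      omega
    let q : ℤ → ℝ := fun j => (carry b m hi (d j) (d (j - 1)) : ℝ)
    have hq : q.support.Finite := by
      refine (hfin.union (finite_support_shift hfin)).subset fun j hj => ?_
      by_contra! h
      simp only [Set.mem_union, Function.mem_support, not_or, not_not, Int.cast_eq_zero] at h
      exact hj (by simp [q, h.1, h.2, hzero])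
    have hbq : ((b : ℝ) • q).support.Finite := hq.subset (Function.support_const_smul_subset _ _)
    have hdiff := finite_support_sub hfin hbq
    have heq : (fun j => (convertedDigit b m hi (d j) (d (j - 1)) (d (j - 2)) : ℝ)) =
        (fun j => (d j : ℝ)) - (b : ℝ) • q - fun j => q (j - 1) := by
      ext j
      simp [convertedDigit, q, sub_sub, one_add_one_eq_two]
    rw [heq]
    refine ⟨finite_support_sub hdiff (finite_support_shift hq), ?_⟩
    have hβ : -(b : ℝ) ≠ 0 := by simpa using hb0.ne'
    rw [seqValue_sub hdiff (finite_support_shift hq), seqValue_sub hfin hbq, seqValue_smul,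
      seqValue_shift hβ]
    ring

/-! ### Obstruction: repeated digits are preserved modulo `β - 1` -/

/-- Doubling the digit at position `r` changes the value by `v r * β ^ (r + 1)` modulo `β - 1`. -/
theorem exists_seqValue_sub_of_repeat {β : ℤ} (hβ : β ≠ 0) {v w : ℤ → ℝ} (r : ℕ)
    (hv : v.support.Finite) (hw : w.support.Finite) (hint : ∀ j, ∃ k : ℤ, v j = k)
    (hle : ∀ j ≤ (r : ℤ), w j = v j) (hgt : ∀ j > (r : ℤ), w j = v (j - 1)) :
    ∃ k : ℤ, seqValue (β : ℝ) w - seqValue (β : ℝ) v = (β - 1) * k + v r * β ^ (r + 1) := by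
  let g : ℤ → ℝ := fun j => if (r : ℤ) < j then v j else 0
  have hg : g.support.Finite := hv.subset fun j hj => by
    simp only [g, Function.mem_support, ne_eq, ite_eq_right_iff, not_forall] at hj
    exact hj.2
  have hδ : (Pi.single ((r : ℤ) + 1) (v r) : ℤ → ℝ).support.Finite :=
    (Set.finite_singleton _).subset Pi.support_single_subset
  have heq : w - v = ((fun j => g (j - 1)) - g) + Pi.single ((r : ℤ) + 1) (v r) := by
    ext j
    simp only [Pi.sub_apply, Pi.add_apply, g, Pi.single_apply]
    rcases lt_trichotomy j (r + 1) with h | rfl | h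
    · simp [hle j (by omega), show ¬(r : ℤ) < j - 1 by omega, show ¬(r : ℤ) < j by omega, h.ne]
    · rw [hgt _ (by omega)]
      simp
      ring
    · simp [hgt j (by omega), show (r : ℤ) < j - 1 by omega, show (r : ℤ) < j by omega, h.ne']
  obtain ⟨k, hk⟩ := exists_int_seqValue β (u := g)
    (fun j => by
      simp only [g]
      split_ifs
      exacts [hint j, ⟨0, by simp⟩])
    (fun j hj => if_neg (by omega))
  have hs := finite_support_shift hg
  refine ⟨k, ?_⟩
  rw [← seqValue_sub hw hv, heq,
    seqValue_add (finite_support_sub hs hg) hδ, seqValue_sub hs hg,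
    seqValue_shift (by exact_mod_cast hβ), seqValue_single, hk,
    show (r : ℤ) + 1 = ((r + 1 : ℕ) : ℤ) by simp, zpow_natCast]
  ring

theorem ParallelConversion.exists_dvd_sub {β : ℤ} (hβ : β ≠ 0) {A : Set ℝ} {m M : ℤ}
    (h : ParallelConversion (β : ℝ) A (intAlphabet m M)) (h0 : (0 : ℝ) ∈ A) {x : ℤ}
    (hx : (x : ℝ) ∈ A) : ∃ y : ℤ, m ≤ y ∧ y ≤ M ∧ β - 1 ∣ x - y := by
  obtain ⟨p, φ, Φ, ⟨r, t, hp, hΦ⟩, hmap, hval⟩ := h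
  let u : ℕ → ℤ → ℝ := fun n j => if 0 ≤ j ∧ j < n then x else 0
  have hu (n : ℕ) (j : ℤ) : u n j ∈ A := by
    simp only [u]
    split_ifs
    exacts [hx, h0]
  have hufin (n : ℕ) : (u n).support.Finite := (Set.finite_Ico (0 : ℤ) n).subset fun j hj => by
    simp only [u, Function.mem_support, ne_eq, ite_eq_right_iff, not_forall] at hj
    exact hj.1
  set n := r + t + 1
  have hsucc : seqValue (β : ℝ) (u (n + 1)) = seqValue (β : ℝ) (u n) + x * β ^ n := by
    have heq : u (n + 1) = u n + Pi.single (n : ℤ) (x : ℝ) := by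
      ext j
      simp only [u, Pi.add_apply, Pi.single_apply]
      split_ifs <;> first | omega | simp
    rw [heq, seqValue_add (hufin n) ((Set.finite_singleton _).subset Pi.support_single_subset),
      seqValue_single, zpow_natCast]
  have hint (j : ℤ) : ∃ k : ℤ, φ (u n) j = k := by
    obtain ⟨k, -, -, hk⟩ := mem_intAlphabet.1 (hmap _ (hu n) j)
    exact ⟨k, hk.symm⟩
  obtain ⟨hvfin, hv⟩ := hval _ (hu n) (hufin n)
  obtain ⟨hwfin, hw⟩ := hval _ (hu (n + 1)) (hufin (n + 1))
  obtain ⟨k, hk⟩ := exists_seqValue_sub_of_repeat hβ r hvfin hwfin hint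
    (fun j hj => by
      rw [hΦ, hΦ]
      congr 1
      ext i
      simp only [u]
      congr 1
      simp only [eq_iff_iff]
      omega)
    (fun j hj => by
      rw [hΦ, hΦ]
      congr 1
      ext i
      have := i.isLt
      simp only [u]
      congr 1
      simp only [eq_iff_iff]
      omega)
  obtain ⟨y, hmy, hyM, hy⟩ := mem_intAlphabet.1 (hmap _ (hu n) r)
  refine ⟨y, hmy, hyM, ?_⟩
  rw [hw, hv, hsucc, ← hy] at hk
  have hz : x * β ^ n = (β - 1) * k + y * β ^ (r + 1) := by
    have : (x : ℝ) * β ^ n = (β - 1) * k + y * β ^ (r + 1) := by linarith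
    exact_mod_cast this
  have h₁ := (sub_one_dvd_pow_sub_one β n).mul_left x
  have h₂ := (sub_one_dvd_pow_sub_one β (r + 1)).mul_left y
  have h₃ : x - y = (β - 1) * k + y * (β ^ (r + 1) - 1) - x * (β ^ n - 1) := by linarith
  rw [h₃]
  exact dvd_sub (dvd_add (dvd_mul_right _ _) h₂) h₁

/-- Theorem (negative integer base): for `β = -b` with `b ≥ 2` an integer, every
alphabet of contiguous integers containing `0` of cardinality `b + 1` allows parallel
addition in base `β`, and no alphabet of contiguous integers containing `0` and `1` of
cardinality at most `b` does. -/
theorem negative_integer_base_minimal_alphabet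
    (b : ℤ) (hb : 2 ≤ b) :
    (∀ m M : ℤ, m ≤ 0 → 0 ≤ M → M - m + 1 = b + 1 →
      ParallelAddition (-(b : ℝ)) (intAlphabet m M)) ∧
    (∀ m M : ℤ, m ≤ 0 → 1 ≤ M → M - m + 1 ≤ b →
      ¬ ParallelAddition (-(b : ℝ)) (intAlphabet m M)) := by
  refine ⟨fun m M hm hM hcard => ?_, fun m M hm hM hcard hpar => ?_⟩
  · obtain rfl : M = m + b := by omega
    exact parallelAddition_neg_base hb hm hM
  · have hpar' : ParallelConversion ((-b : ℤ) : ℝ) (intAlphabet m M + intAlphabet m M)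
        (intAlphabet m M) := by
      rw [Int.cast_neg]
      exact hpar
    have hmem (k : ℤ) (hk : m ≤ k) (hk' : k ≤ M) : (k : ℝ) ∈ intAlphabet m M :=
      mem_intAlphabet.2 ⟨k, hk, hk', rfl⟩
    obtain ⟨y, hmy, hyM, hdvd⟩ := hpar'.exists_dvd_sub (by omega) (x := M + 1)
      (Set.mem_add.2 ⟨_, hmem 0 hm (by omega), _, hmem 0 hm (by omega), by simp⟩)
      (Set.mem_add.2 ⟨_, hmem M (by omega) le_rfl, _, hmem 1 (by omega) hM, by simp⟩)
    have hle := Int.le_of_dvd (by omega) (neg_dvd.2 hdvd)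
    omega
end

section
/- Let a and b be co-prime positive integers with a > b ≥ 1 and let β = −a/b. Then for every d ∈ {0, 1, …, a+b−1}, the alphabet A_{−d} = {−d, …, 0, …, a+b−1−d} of cardinality a+b allows parallel addition on Fin_{A_{−d}}(β); that is, every alphabet of contiguous integers containing 0 of cardinality a+b allows parallel addition in base −a/b. -/
open scoped Pointwise

/-- A digit set conversion on integer strings that is a sliding block map: it commutes with the
shift and the digit at position `j` depends only on the input digits at distance at most `N`. -/
def HasSlidingConversion (β : ℝ) (A B : Set ℤ) : Prop :=
  ∃ (N : ℕ) (ψ : (ℤ → ℤ) → ℤ → ℤ),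
    (∀ (u v : ℤ → ℤ) (j : ℤ), (∀ i, |i - j| ≤ (N : ℤ) → u i = v i) → ψ u j = ψ v j) ∧
    (∀ (u : ℤ → ℤ) (k j : ℤ), ψ (fun i => u (i + k)) j = ψ u (j + k)) ∧
    (∀ u : ℤ → ℤ, (∀ j, u j ∈ A) → ∀ j, ψ u j ∈ B) ∧
    ∀ u : ℤ → ℤ, (Function.support u).Finite → (Function.support (ψ u)).Finite ∧
      seqValue β (fun j => (ψ u j : ℝ)) = seqValue β (fun j => (u j : ℝ))

lemma HasSlidingConversion.refl (β : ℝ) (A : Set ℤ) : HasSlidingConversion β A A :=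
  ⟨0, id, fun _ _ j h => h j (by simp), fun _ _ _ => rfl, fun _ h => h, fun _ h => ⟨h, rfl⟩⟩

lemma HasSlidingConversion.trans {β : ℝ} {A B C : Set ℤ} (hAB : HasSlidingConversion β A B)
    (hBC : HasSlidingConversion β B C) : HasSlidingConversion β A C := by
  obtain ⟨N, ψ, hloc, hshift, hmaps, hval⟩ := hAB
  obtain ⟨N', ψ', hloc', hshift', hmaps', hval'⟩ := hBC
  refine ⟨N + N', fun u => ψ' (ψ u), fun u v j h => ?_, fun u k j => ?_,
    fun u hu => hmaps' _ (hmaps u hu), fun u hu => ?_⟩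
  · refine hloc' _ _ j fun i hi => hloc u v i fun l hl => h l ?_
    have := abs_sub_le l i j
    push_cast
    linarith
  · have h : ψ (fun i => u (i + k)) = fun i => ψ u (i + k) := funext (hshift u k)
    simp only [h, hshift']
  · obtain ⟨hfin, hv⟩ := hval u hu
    obtain ⟨hfin', hv'⟩ := hval' _ hfin
    exact ⟨hfin', hv'.trans hv⟩

lemma HasSlidingConversion.parallelConversion {β : ℝ} {A B : Set ℤ}
    (h : HasSlidingConversion β A B) :
    ParallelConversion β ((fun k : ℤ => (k : ℝ)) '' A) ((fun k : ℤ => (k : ℝ)) '' B) := by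
  obtain ⟨N, ψ, hloc, hshift, hmaps, hval⟩ := h
  refine ⟨N + N + 1, fun u j => (ψ (fun i => ⌊u i⌋) j : ℝ),
    fun w => (ψ (fun i => if h : ((N : ℤ) - i).toNat < N + N + 1
      then ⌊w ⟨((N : ℤ) - i).toNat, h⟩⌋ else 0) 0 : ℝ), ⟨N, N, rfl, fun u j => ?_⟩, ?_, ?_⟩
  · have hj := hshift (fun i => ⌊u i⌋) j 0
    rw [zero_add] at hj
    simp only [← hj]
    congr 1
    refine hloc _ _ 0 fun i hi => ?_
    rw [sub_zero, abs_le] at hi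
    rw [dif_pos (by omega)]
    refine congrArg (fun k => ⌊u k⌋) ?_
    omega
  · intro u hu j
    refine ⟨_, hmaps _ (fun i => ?_) j, rfl⟩
    obtain ⟨k, hk, hki⟩ := hu i
    simpa [← hki] using hk
  · intro u hu hfin
    have hfloor : (fun j => ((⌊u j⌋ : ℤ) : ℝ)) = u := by
      funext i
      obtain ⟨k, -, hki⟩ := hu i
      simp [← hki]
    obtain ⟨hfin', hv⟩ := hval (fun i => ⌊u i⌋)
      (hfin.subset fun i hi h0 => hi (by simp [h0]))
    rw [hfloor] at hv
    exact ⟨hfin'.subset fun i hi h0 => hi (by simp [h0]), hv⟩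

/-- Subtracting a finitely supported string of multiples of `a + b * X`, where `β` is the root
`-a/b`, does not change the value. -/
lemma seqValue_sub_carry {a b : ℤ} {β : ℝ} (hβ : β ≠ 0) (hroot : (a : ℝ) + b * β = 0)
    {u q : ℤ → ℤ} (hu : (Function.support u).Finite) (hq : (Function.support q).Finite) :
    seqValue β (fun j => ((u j - a * q j - b * q (j - 1) : ℤ) : ℝ)) =
      seqValue β (fun j => (u j : ℝ)) := by
  have hq' : (Function.support fun j => q (j - 1)).Finite :=
    hq.preimage (sub_left_injective (b := (1 : ℤ))).injOn
  have f₁ : (Function.support fun j : ℤ => (u j : ℝ) * β ^ j).Finite :=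
    hu.subset fun i hi h0 => hi (by simp [h0])
  have f₂ : (Function.support fun j : ℤ => (a * q j : ℝ) * β ^ j).Finite :=
    hq.subset fun i hi h0 => hi (by simp [h0])
  have f₃ : (Function.support fun j : ℤ => (b * q (j - 1) : ℝ) * β ^ j).Finite :=
    hq'.subset fun i hi h0 => hi (by simp only at h0; simp [h0])
  have hcarry : ∑ᶠ j : ℤ, (b * q (j - 1) : ℝ) * β ^ j = -∑ᶠ j : ℤ, (a * q j : ℝ) * β ^ j := by
    rw [← finsum_neg_distrib, ← finsum_comp_equiv (Equiv.addRight (1 : ℤ))]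
    refine finsum_congr fun j => ?_
    rw [Equiv.coe_addRight, add_sub_cancel_right, zpow_add_one₀ hβ]
    linear_combination (q j : ℝ) * β ^ j * hroot
  unfold seqValue
  push_cast
  simp only [sub_mul]
  rw [finsum_sub_distrib ((f₁.union f₂).subset (Function.support_sub _ _)) f₃, finsum_sub_distrib f₁ f₂, hcarry]
  ring

lemma hasSlidingConversion_of_carry {a b : ℤ} {β : ℝ} (hβ : β ≠ 0)
    (hroot : (a : ℝ) + b * β = 0) {A B : Set ℤ} (c : ℤ → ℤ → ℤ) (hc : c 0 0 = 0)
    (h : ∀ x ∈ A, ∀ y ∈ A, ∀ z ∈ A, x - a * c x y - b * c y z ∈ B) :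
    HasSlidingConversion β A B := by
  refine ⟨2, fun u j => u j - a * c (u j) (u (j - 1)) - b * c (u (j - 1)) (u (j - 2)),
    fun u v j huv => ?_, fun u k j => ?_, fun u hu j => h _ (hu _) _ (hu _) _ (hu _),
    fun u hu => ?_⟩
  · simp only
    rw [huv j (by simp), huv (j - 1) (by simp), huv (j - 2) (by simp)]
  · simp only [sub_add_eq_add_sub]
  · have hshift (k : ℤ) : (Function.support fun j => u (j - k)).Finite :=
      hu.preimage (sub_left_injective (b := k)).injOn
    have hq : (Function.support fun j => c (u j) (u (j - 1))).Finite := by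
      refine (hu.union (hshift 1)).subset fun j hj => ?_
      by_contra hn
      simp only [Set.mem_union, Function.mem_support, not_or, not_not] at hn
      exact hj (by simp [hn.1, hn.2, hc])
    constructor
    · refine (hu.union ((hshift 1).union (hshift 2))).subset fun j hj => ?_
      by_contra hn
      simp only [Set.mem_union, Function.mem_support, not_or, not_not] at hn
      exact hj (by simp [hn.1, hn.2.1, hn.2.2, hc])
    · have hval := seqValue_sub_carry hβ hroot hu hq
      simpa only [sub_sub _ (1 : ℤ) 1, one_add_one_eq_two] using hval

/-- The carry used in base `-a/b` to lower the largest digit of an alphabet while aiming at the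
alphabet `{m, …, m + a + b - 1}`; `x` is the current digit and `y` its right neighbour. -/
def topCarry (a b m x y : ℤ) : ℤ :=
  if m + a + b ≤ x then 1
  else if m + a ≤ x ∧ y < m + b then 1
  else if x < m + b ∧ m + a ≤ y then -1
  else 0

lemma topCarry_zero_zero {a b m : ℤ} (hab : b < a) (hm : 0 < m + a + b) :
    topCarry a b m 0 0 = 0 := by
  unfold topCarry
  split_ifs <;> omega

lemma sub_topCarry_mem_Icc {a b m k l x y z : ℤ} (hb : 1 ≤ b) (hab : b < a) (hk : 0 ≤ k)
    (hl : 0 ≤ l) (hx : x ∈ Set.Icc (m - l) (m + a + b + k)) :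
    x - a * topCarry a b m x y - b * topCarry a b m y z ∈
      Set.Icc (m - l) (m + a + b - 1 + k) := by
  simp only [Set.mem_Icc] at hx ⊢
  unfold topCarry
  split_ifs <;> constructor <;> omega

lemma hasSlidingConversion_Icc {a b m : ℤ} {β : ℝ} (hβ : β ≠ 0) (hroot : (a : ℝ) + b * β = 0)
    (hb : 1 ≤ b) (hab : b < a) (hm : m ≤ 0) (hM : 0 ≤ m + a + b - 1) (k l : ℕ) :
    HasSlidingConversion β (Set.Icc (m - l) (m + a + b - 1 + k))
      (Set.Icc m (m + a + b - 1)) := by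
  induction k with
  | succ k ih =>
    refine HasSlidingConversion.trans (hasSlidingConversion_of_carry hβ hroot (topCarry a b m)
      (topCarry_zero_zero hab (by omega)) fun x hx y _ z _ => ?_) ih
    refine sub_topCarry_mem_Icc hb hab (by omega) (by omega) ?_
    simp only [Set.mem_Icc] at hx ⊢
    omega
  | zero =>
    induction l with
    | zero => simpa using HasSlidingConversion.refl β _
    | succ l ih =>
      refine HasSlidingConversion.trans (hasSlidingConversion_of_carry hβ hroot
        (fun x y => -topCarry a b (-(m + a + b - 1)) (-x) (-y)) ?_ fun x hx y _ z _ => ?_) ih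
      · rw [neg_zero, topCarry_zero_zero hab (by omega), neg_zero]
      · have h := sub_topCarry_mem_Icc (m := -(m + a + b - 1)) (k := l) (l := 0) (x := -x)
          (y := -y) (z := -z) hb hab (by omega) le_rfl
          (by simp only [Set.mem_Icc] at hx ⊢; omega)
        simp only [Set.mem_Icc, mul_neg] at h ⊢
        omega

lemma intAlphabet_add_subset (m M : ℤ) :
    intAlphabet m M + intAlphabet m M ⊆ intAlphabet (m + m) (M + M) := by
  rintro _ ⟨_, ⟨x, hx, rfl⟩, _, ⟨y, hy, rfl⟩, rfl⟩
  exact ⟨x + y, ⟨add_le_add hx.1 hy.1, add_le_add hx.2 hy.2⟩, by push_cast; rfl⟩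

lemma ParallelConversion.mono_left {β : ℝ} {A A' B : Set ℝ} (hA : A ⊆ A')
    (h : ParallelConversion β A' B) : ParallelConversion β A B := by
  obtain ⟨p, φ, Φ, hloc, hmaps, hval⟩ := h
  exact ⟨p, φ, Φ, hloc, fun u hu => hmaps u fun j => hA (hu j),
    fun u hu => hval u fun j => hA (hu j)⟩

/-- Proposition (negative rational base): for co-prime positive integers `a > b ≥ 1`
and `β = -a/b`, every alphabet of contiguous integers containing `0` of cardinality
`a + b`, i.e. `A₋d = {-d, …, 0, …, a+b-1-d}` for `d ∈ {0, …, a+b-1}`, allows parallel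
addition in base `β`. -/
theorem negative_rational_base_parallelAddition
    (a b : ℕ) (hco : Nat.Coprime a b) (hb : 1 ≤ b) (hab : b < a) :
    ∀ d : ℤ, 0 ≤ d → d ≤ (a : ℤ) + (b : ℤ) - 1 →
      ParallelAddition (-((a : ℝ) / (b : ℝ)))
        (intAlphabet (-d) ((a : ℤ) + (b : ℤ) - 1 - d)) := by
  intro d hd hd'
  have hb0 : (b : ℝ) ≠ 0 := Nat.cast_ne_zero.mpr (by omega)
  have ha0 : (a : ℝ) ≠ 0 := Nat.cast_ne_zero.mpr (by omega)
  have hβ : -((a : ℝ) / (b : ℝ)) ≠ 0 := neg_ne_zero.mpr (div_ne_zero ha0 hb0)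
  have hroot : ((a : ℤ) : ℝ) + ((b : ℤ) : ℝ) * -((a : ℝ) / (b : ℝ)) = 0 := by
    push_cast
    field_simp
    ring
  refine ParallelConversion.mono_left (intAlphabet_add_subset _ _) ?_
  have h := (hasSlidingConversion_Icc (m := -d) hβ hroot (by omega) (by omega) (by omega)
    (by omega) ((a : ℤ) + b - 1 - d).toNat d.toNat).parallelConversion
  rw [Int.toNat_of_nonneg (sub_nonneg.mpr hd'), Int.toNat_of_nonneg hd] at h
  unfold intAlphabet
  convert h using 3 <;> ring_nf
end
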